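/- Let d ≥ 2 and h ≥ 1 with d even. Then ∑_{v | d^∞, ν_2(v) = ν_2(h)} ∑_{α | d, α odd} μ(α)·gcd(αv,h)/(φ(dv)·α·v) = (3/2)·S(d,h), where S(d,h) = (1/(d(h,d^∞)))∏_{p|d} p²/(p²−1). -/

import Mathlib

open ArithmeticFunction
open scoped Classical

/-- The part of `h` supported on the primes dividing `d`, usually written `(h, d^∞)`. -/
def supportedPart (d h : ℕ) : ℕ := ∏ p ∈ d.primeFactors, p ^ h.factorization p

theorem supportedPart_pos (d h : ℕ) : 0 < supportedPart d h :=
  Finset.prod_pos fun _ hp => pow_pos (Nat.prime_of_mem_primeFactors hp).pos _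

theorem supportedPart_factorization_of_mem {d p : ℕ} (h : ℕ) (hp : p ∈ d.primeFactors) :
    (supportedPart d h).factorization p = h.factorization p := by
  rw [supportedPart, Nat.factorization_prod_apply fun q hq =>
    (pow_pos (Nat.prime_of_mem_primeFactors hq).pos _).ne', Finset.sum_eq_single_of_mem p hp]
  · simp [(Nat.prime_of_mem_primeFactors hp).factorization]
  · intro q hq hqp
    simp [(Nat.prime_of_mem_primeFactors hq).factorization, hqp]

theorem supportedPart_dvd_of_factorization_le {d h v : ℕ} (hv : v ≠ 0)
    (hle : ∀ p ∈ d.primeFactors, h.factorization p ≤ v.factorization p) :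
    supportedPart d h ∣ v := by
  refine Finset.prod_dvd_of_isRelPrime (fun p hp q hq hpq => ?_) fun p hp => ?_
  · exact Nat.coprime_iff_isRelPrime.1 (Nat.Coprime.pow _ _
      ((Nat.coprime_primes (Nat.prime_of_mem_primeFactors hp)
        (Nat.prime_of_mem_primeFactors hq)).2 hpq))
  · exact ((Nat.prime_of_mem_primeFactors hp).pow_dvd_iff_le_factorization hv).2 (hle p hp)

theorem supportedPart_dvd {d h : ℕ} (hh : h ≠ 0) : supportedPart d h ∣ h :=
  supportedPart_dvd_of_factorization_le hh fun _ _ => le_rfl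

theorem coprime_div_supportedPart {d h : ℕ} (hd : d ≠ 0) (hh : h ≠ 0) :
    Nat.Coprime d (h / supportedPart d h) := by
  refine Nat.coprime_of_dvd fun p hp hpd hph => ?_
  have hmem : p ∈ d.primeFactors := Nat.mem_primeFactors.2 ⟨hp, hpd, hd⟩
  have hne : h / supportedPart d h ≠ 0 :=
    (Nat.div_pos (Nat.le_of_dvd (Nat.pos_of_ne_zero hh) (supportedPart_dvd hh))
      (supportedPart_pos d h)).ne'
  have hpos := (hp.dvd_iff_one_le_factorization hne).1 hph
  rw [Nat.factorization_div (supportedPart_dvd hh), Finsupp.tsub_apply,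
    supportedPart_factorization_of_mem h hmem] at hpos
  omega

theorem prime_dvd_of_dvd_supportedPart {d h q : ℕ} (hq : q.Prime)
    (hqm : q ∣ supportedPart d h) : q ∣ d := by
  obtain ⟨p, hp, hqp⟩ := (hq.prime.dvd_finsetProd_iff _).1 hqm
  rw [(Nat.prime_dvd_prime_iff_eq hq (Nat.prime_of_mem_primeFactors hp)).1 (hq.dvd_of_dvd_pow hqp)]
  exact Nat.dvd_of_mem_primeFactors hp

theorem coprime_of_prime_dvd {d v k : ℕ} (hv : ∀ q : ℕ, q.Prime → q ∣ v → q ∣ d)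
    (hdk : Nat.Coprime d k) : Nat.Coprime v k :=
  Nat.coprime_of_dvd fun p hp hpv hpk =>
    hp.ne_one (Nat.eq_one_of_dvd_coprimes hdk (hv p hp hpv) hpk)

theorem gcd_supportedPart_mul {d h w : ℕ} (hd : d ≠ 0) (hh : h ≠ 0)
    (hw : ∀ q : ℕ, q.Prime → q ∣ w → q ∣ d) :
    Nat.gcd (supportedPart d h * w) h = supportedPart d h := by
  conv_lhs => arg 2; rw [← Nat.mul_div_cancel' (supportedPart_dvd (d := d) hh)]
  rw [Nat.gcd_mul_left, coprime_of_prime_dvd hw (coprime_div_supportedPart hd hh), mul_one]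

theorem totient_mul_of_prime_dvd {d v : ℕ} (hd : d ≠ 0) (hv : v ≠ 0)
    (h : ∀ q : ℕ, q.Prime → q ∣ v → q ∣ d) : Nat.totient (d * v) = Nat.totient d * v := by
  have hpf : (d * v).primeFactors = d.primeFactors := by
    rw [Nat.primeFactors_mul hd hv, Finset.union_eq_left]
    exact fun q hq => Nat.mem_primeFactors.2 ⟨Nat.prime_of_mem_primeFactors hq,
      h q (Nat.prime_of_mem_primeFactors hq) (Nat.dvd_of_mem_primeFactors hq), hd⟩
  have hQ : (Nat.totient (d * v) : ℚ) = Nat.totient d * v := by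
    rw [Nat.totient_eq_mul_prod_factors, Nat.totient_eq_mul_prod_factors, hpf]
    push_cast
    ring
  exact_mod_cast hQ

theorem gcd_mul_eq_gcd_mul_gcd_div {h : ℕ} (a v : ℕ) (hh : 0 < h) :
    Nat.gcd (a * v) h = Nat.gcd v h * Nat.gcd a (h / Nat.gcd v h) := by
  have hg : 0 < Nat.gcd v h := Nat.gcd_pos_of_pos_right v hh
  have hc : Nat.Coprime (v / Nat.gcd v h) (h / Nat.gcd v h) := Nat.coprime_div_gcd_div_gcd hg
  have key : Nat.gcd (a * (v / Nat.gcd v h)) (h / Nat.gcd v h) = Nat.gcd a (h / Nat.gcd v h) :=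
    Nat.Coprime.gcd_mul_right_cancel a hc
  rw [← key, ← Nat.gcd_mul_left, Nat.mul_left_comm, Nat.mul_div_cancel' (Nat.gcd_dvd_left v h),
    Nat.mul_div_cancel' (Nat.gcd_dvd_right v h)]

theorem sum_divisors_moebius_mul_gcd_div {n : ℕ} (k : ℕ) (hn : Squarefree n) :
    ∑ a ∈ n.divisors, (moebius a : ℝ) * (Nat.gcd a k / a) =
      ∏ p ∈ n.primeFactors, (1 - (Nat.gcd p k : ℝ) / p) := by
  let f : ArithmeticFunction ℝ := ⟨fun a => (Nat.gcd a k : ℝ) / a, by simp⟩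
  have hf : f.IsMultiplicative := by
    refine ⟨by simp [f], fun {a b} hab => ?_⟩
    have hgcd : Nat.gcd (a * b) k = Nat.gcd a k * Nat.gcd b k := by
      simpa only [Nat.gcd_comm] using Nat.Coprime.gcd_mul k hab
    simp only [f, coe_mk, hgcd, Nat.cast_mul, mul_div_mul_comm]
  exact (hf.prodPrimeFactors_one_sub_of_squarefree f hn).symm

theorem sum_odd_divisors_moebius_mul {d : ℕ} (hd : d ≠ 0) (f : ℕ → ℝ) :
    ∑ a ∈ d.divisors.filter (fun a => ¬ 2 ∣ a), (moebius a : ℝ) * f a =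
      ∑ a ∈ (∏ p ∈ d.primeFactors.erase 2, p).divisors, (moebius a : ℝ) * f a := by
  have hprime : ∀ p ∈ d.primeFactors.erase 2, p.Prime := fun p hp =>
    Nat.prime_of_mem_primeFactors (Finset.mem_of_mem_erase hp)
  have hne : ∏ p ∈ d.primeFactors.erase 2, p ≠ 0 :=
    Finset.prod_ne_zero_iff.2 fun p hp => (hprime p hp).ne_zero
  symm
  refine Finset.sum_subset (fun a ha => ?_) fun a ha ha' => ?_
  · have hdvd := Nat.dvd_of_mem_divisors ha
    refine Finset.mem_filter.2 ⟨Nat.mem_divisors.2 ⟨hdvd.trans ?_, hd⟩, fun h2 => ?_⟩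
    · exact (Finset.prod_dvd_prod_of_subset _ _ _ (Finset.erase_subset _ _)).trans
        (Nat.prod_primeFactors_dvd d)
    · have : 2 ∈ (∏ p ∈ d.primeFactors.erase 2, p).primeFactors :=
        Nat.mem_primeFactors.2 ⟨Nat.prime_two, h2.trans hdvd, hne⟩
      simp [Nat.primeFactors_prod hprime] at this
  · obtain ⟨hdiv, h2⟩ := Finset.mem_filter.1 ha
    by_cases hsq : Squarefree a
    · refine absurd (Nat.mem_divisors.2 ⟨?_, hne⟩) ha'
      rw [← Nat.prod_primeFactors_of_squarefree hsq]
      refine Finset.prod_dvd_prod_of_subset _ _ _ fun p hp => Finset.mem_erase.2 ⟨?_, ?_⟩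
      · rintro rfl
        exact h2 (Nat.dvd_of_mem_primeFactors hp)
      · exact Nat.primeFactors_mono (Nat.dvd_of_mem_divisors hdiv) hd hp
    · simp [moebius_eq_zero_of_not_squarefree hsq]

theorem sum_odd_divisors_gcd {d h : ℕ} (v : ℕ) (hd : d ≠ 0) (hh : 0 < h) :
    ∑ α ∈ d.divisors.filter (fun α => ¬ 2 ∣ α),
        (moebius α : ℝ) * Nat.gcd (α * v) h / (Nat.totient (d * v) * α * v) =
      (Nat.gcd v h : ℝ) / (Nat.totient (d * v) * v) *
        ∏ p ∈ d.primeFactors.erase 2, (1 - (Nat.gcd p (h / Nat.gcd v h) : ℝ) / p) := by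
  have hprime : ∀ p ∈ d.primeFactors.erase 2, p.Prime := fun p hp =>
    Nat.prime_of_mem_primeFactors (Finset.mem_of_mem_erase hp)
  have hsq : Squarefree (∏ p ∈ d.primeFactors.erase 2, p) :=
    Finset.squarefree_prod_of_pairwise_isCoprime (fun p hp q hq hpq =>
      Nat.coprime_iff_isRelPrime.1 ((Nat.coprime_primes (hprime p hp) (hprime q hq)).2 hpq))
      fun p hp => (hprime p hp).prime.squarefree
  have hprod := sum_divisors_moebius_mul_gcd_div (h / Nat.gcd v h) hsq
  rw [Nat.primeFactors_prod hprime, ← sum_odd_divisors_moebius_mul hd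
    fun a => (Nat.gcd a (h / Nat.gcd v h) : ℝ) / a] at hprod
  rw [← hprod, Finset.mul_sum]
  refine Finset.sum_congr rfl fun a _ => ?_
  rw [gcd_mul_eq_gcd_mul_gcd_div a v hh]
  push_cast
  simp only [div_eq_mul_inv, mul_inv]
  ring

theorem hasSum_factoredNumbers_inv_sq {s : Finset ℕ} (hs : ∀ p ∈ s, p.Prime) :
    HasSum (fun w : Nat.factoredNumbers s => ((w : ℝ) ^ 2)⁻¹)
      (∏ p ∈ s, (p : ℝ) ^ 2 / ((p : ℝ) ^ 2 - 1)) := by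
  let f : ℕ →* ℝ :=
    { toFun := fun n => ((n : ℝ) ^ 2)⁻¹
      map_one' := by simp
      map_mul' := fun a b => by push_cast; rw [mul_pow, mul_inv] }
  have hlt : ∀ {p : ℕ}, p.Prime → ‖f p‖ < 1 := fun {p} hp => by
    have h1 : (1 : ℝ) < p := by exact_mod_cast hp.one_lt
    change ‖((p : ℝ) ^ 2)⁻¹‖ < 1
    rw [Real.norm_of_nonneg (by positivity)]
    exact inv_lt_one_of_one_lt₀ (one_lt_pow₀ h1 two_ne_zero)
  have hsum :=
    (EulerProduct.summable_and_hasSum_factoredNumbers_prod_filter_prime_geometric hlt s).2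
  rw [Finset.filter_true_of_mem hs] at hsum
  refine (Finset.prod_congr rfl fun p hp => ?_ :
    ∏ p ∈ s, (1 - f p)⁻¹ = ∏ p ∈ s, (p : ℝ) ^ 2 / ((p : ℝ) ^ 2 - 1)) ▸ hsum
  have h1 : (1 : ℝ) < p := by exact_mod_cast (hs p hp).one_lt
  have h2 : (p : ℝ) ^ 2 - 1 ≠ 0 := (sub_pos.2 (one_lt_pow₀ h1 two_ne_zero)).ne'
  change (1 - ((p : ℝ) ^ 2)⁻¹)⁻¹ = _
  field_simp

/-- A `v` contributes to the sum only if it is `(h, d^∞)` times a number composed of odd primes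
dividing `d`. -/
theorem exists_factoredNumbers_eq_mul {d h v : ℕ} (hd : d ≠ 0) (hh : h ≠ 0) (h2d : 2 ∣ d)
    (hv : v ≠ 0) (hvd : ∀ q : ℕ, q.Prime → q ∣ v → q ∣ d)
    (hv2 : v.factorization 2 = h.factorization 2)
    (hprod : ∏ p ∈ d.primeFactors.erase 2, (1 - (Nat.gcd p (h / Nat.gcd v h) : ℝ) / p) ≠ 0) :
    ∃ w : Nat.factoredNumbers (d.primeFactors.erase 2), supportedPart d h * w = v := by
  have hdvd : supportedPart d h ∣ v := by
    refine supportedPart_dvd_of_factorization_le hv fun p hp => ?_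
    have hpp := Nat.prime_of_mem_primeFactors hp
    by_cases hp2 : p = 2
    · rw [hp2, hv2]
    by_contra! hlt
    refine Finset.prod_ne_zero_iff.1 hprod p (Finset.mem_erase.2 ⟨hp2, hp⟩) ?_
    have hpk : p ∣ h / Nat.gcd v h := by
      refine (hpp.dvd_iff_one_le_factorization (Nat.div_pos (Nat.gcd_le_right v
        (Nat.pos_of_ne_zero hh)) (Nat.gcd_pos_of_pos_right v (Nat.pos_of_ne_zero hh))).ne').2 ?_
      rw [Nat.factorization_div (Nat.gcd_dvd_right v h), Nat.factorization_gcd hv hh]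
      simp only [Finsupp.tsub_apply, Finsupp.inf_apply]
      omega
    have hp0 : (p : ℝ) ≠ 0 := by exact_mod_cast hpp.ne_zero
    rw [Nat.gcd_eq_left hpk, div_self hp0, sub_self]
  obtain ⟨w, rfl⟩ := hdvd
  have hw0 : w ≠ 0 := right_ne_zero_of_mul hv
  refine ⟨⟨w, Nat.mem_factoredNumbers'.2 fun p hp hpw => Finset.mem_erase.2 ⟨?_, ?_⟩⟩, rfl⟩
  · rintro rfl
    rw [Nat.factorization_mul (supportedPart_pos d h).ne' hw0, Finsupp.add_apply,
      supportedPart_factorization_of_mem h (Nat.mem_primeFactors.2 ⟨hp, h2d, hd⟩)] at hv2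
    have := (hp.dvd_iff_one_le_factorization hw0).1 hpw
    omega
  · exact Nat.mem_primeFactors.2 ⟨hp, hvd p hp (hpw.mul_left _), hd⟩

theorem sum_odd_divisors_supportedPart_mul {d h w : ℕ} (hd : d ≠ 0) (hh : 0 < h) (hw : w ≠ 0)
    (hwd : ∀ q : ℕ, q.Prime → q ∣ w → q ∣ d) :
    ∑ α ∈ d.divisors.filter (fun α => ¬ 2 ∣ α), (moebius α : ℝ) *
        Nat.gcd (α * (supportedPart d h * w)) h /
          (Nat.totient (d * (supportedPart d h * w)) * α * (supportedPart d h * w : ℕ)) =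
      (∏ p ∈ d.primeFactors.erase 2, (1 - (p : ℝ)⁻¹)) / (Nat.totient d * supportedPart d h) *
        ((w : ℝ) ^ 2)⁻¹ := by
  have hm := supportedPart_pos d h
  rw [sum_odd_divisors_gcd _ hd hh, gcd_supportedPart_mul hd hh.ne' hwd,
    totient_mul_of_prime_dvd hd (mul_ne_zero hm.ne' hw) fun q hq hqv =>
      (hq.dvd_mul.1 hqv).elim (prime_dvd_of_dvd_supportedPart hq) (hwd q hq)]
  have hP : ∏ p ∈ d.primeFactors.erase 2, (1 - (Nat.gcd p (h / supportedPart d h) : ℝ) / p) =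
      ∏ p ∈ d.primeFactors.erase 2, (1 - (p : ℝ)⁻¹) := by
    refine Finset.prod_congr rfl fun p hp => ?_
    have hpd := Nat.dvd_of_mem_primeFactors (Finset.mem_of_mem_erase hp)
    rw [(coprime_div_supportedPart hd hh.ne').coprime_dvd_left hpd, Nat.cast_one, one_div]
  rw [hP]
  have hmR : (supportedPart d h : ℝ) ≠ 0 := by exact_mod_cast hm.ne'
  have hwR : (w : ℝ) ≠ 0 := by exact_mod_cast hw
  have htR : (Nat.totient d : ℝ) ≠ 0 := by
    exact_mod_cast (Nat.totient_pos.2 (Nat.pos_of_ne_zero hd)).ne'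
  push_cast
  field_simp

theorem odd_alpha_sum_eval (d h : ℕ) (hd : 2 ≤ d) (hh : 1 ≤ h) (h2d : 2 ∣ d) :
    (∑' v : ℕ, if 0 < v ∧ (∀ q : ℕ, q.Prime → q ∣ v → q ∣ d) ∧
          v.factorization 2 = h.factorization 2 then
        ∑ α ∈ d.divisors.filter (fun α => ¬ 2 ∣ α),
          (moebius α : ℝ) * Nat.gcd (α * v) h / (Nat.totient (d * v) * α * v)
      else 0)
    = (3 / 2 : ℝ) *
        ((1 / ((d : ℝ) * ∏ p ∈ d.primeFactors, (p : ℝ) ^ (h.factorization p))) *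
          ∏ p ∈ d.primeFactors, (p : ℝ) ^ 2 / ((p : ℝ) ^ 2 - 1)) := by
  have hd0 : d ≠ 0 := by omega
  have h2mem : 2 ∈ d.primeFactors := Nat.mem_primeFactors.2 ⟨Nat.prime_two, h2d, hd0⟩
  have hprime : ∀ p ∈ d.primeFactors.erase 2, p.Prime := fun p hp =>
    Nat.prime_of_mem_primeFactors (Finset.mem_of_mem_erase hp)
  have hm := supportedPart_pos d h
  have hinj : Function.Injective
      fun w : Nat.factoredNumbers (d.primeFactors.erase 2) => supportedPart d h * (w : ℕ) :=
    fun a b hab => Subtype.ext (Nat.eq_of_mul_eq_mul_left hm hab)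
  have hsum := (hasSum_factoredNumbers_inv_sq hprime).mul_left
    ((∏ p ∈ d.primeFactors.erase 2, (1 - (p : ℝ)⁻¹)) / (Nat.totient d * supportedPart d h))
  have htotal : HasSum (fun v : ℕ => if 0 < v ∧ (∀ q : ℕ, q.Prime → q ∣ v → q ∣ d) ∧
          v.factorization 2 = h.factorization 2 then
        ∑ α ∈ d.divisors.filter (fun α => ¬ 2 ∣ α),
          (moebius α : ℝ) * Nat.gcd (α * v) h / (Nat.totient (d * v) * α * v)
      else 0)
      ((∏ p ∈ d.primeFactors.erase 2, (1 - (p : ℝ)⁻¹)) / (Nat.totient d * supportedPart d h) *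
        ∏ p ∈ d.primeFactors.erase 2, (p : ℝ) ^ 2 / ((p : ℝ) ^ 2 - 1)) := by
    refine (hinj.hasSum_iff fun v hv => ?_).1 ?_
    · split_ifs with hcond
      · obtain ⟨hv0, hvd, hv2⟩ := hcond
        rw [sum_odd_divisors_gcd v hd0 hh]
        by_contra hne
        exact hv (exists_factoredNumbers_eq_mul hd0 (by omega) h2d hv0.ne' hvd hv2
          (right_ne_zero_of_mul hne))
      · rfl
    · refine Eq.subst (motive := fun g => HasSum g _) (funext fun ⟨w, hw⟩ => Eq.symm ?_) hsum
      have hw0 := Nat.ne_zero_of_mem_factoredNumbers hw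
      have hws := Nat.mem_factoredNumbers'.1 hw
      have hwd : ∀ q : ℕ, q.Prime → q ∣ w → q ∣ d := fun q hq hqw =>
        Nat.dvd_of_mem_primeFactors (Finset.mem_of_mem_erase (hws q hq hqw))
      have h2w : w.factorization 2 = 0 := Nat.factorization_eq_zero_of_not_dvd fun h2 =>
        Finset.notMem_erase 2 _ (hws 2 Nat.prime_two h2)
      have hcond : 0 < supportedPart d h * w ∧
          (∀ q : ℕ, q.Prime → q ∣ supportedPart d h * w → q ∣ d) ∧
          (supportedPart d h * w).factorization 2 = h.factorization 2 := by
        refine ⟨Nat.mul_pos hm (Nat.pos_of_ne_zero hw0), fun q hq hqv =>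
          (hq.dvd_mul.1 hqv).elim (prime_dvd_of_dvd_supportedPart hq) (hwd q hq), ?_⟩
        rw [Nat.factorization_mul hm.ne' hw0, Finsupp.add_apply,
          supportedPart_factorization_of_mem h h2mem, h2w, add_zero]
      simp only [Function.comp_apply]
      rw [if_pos hcond, sum_odd_divisors_supportedPart_mul hd0 hh hw0 hwd]
  rw [htotal.tsum_eq]
  have hφ : (Nat.totient d : ℝ) = d * ∏ p ∈ d.primeFactors, (1 - (p : ℝ)⁻¹) := by
    simpa using congrArg (Rat.cast : ℚ → ℝ) (Nat.totient_eq_mul_prod_factors d)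
  have hP : ∏ p ∈ d.primeFactors.erase 2, (1 - (p : ℝ)⁻¹) ≠ 0 :=
    Finset.prod_ne_zero_iff.2 fun p hp => by
      have h1 : (1 : ℝ) < p := by exact_mod_cast (hprime p hp).one_lt
      exact (sub_pos.2 (inv_lt_one_of_one_lt₀ h1)).ne'
  have hmR : ∏ p ∈ d.primeFactors, (p : ℝ) ^ h.factorization p = supportedPart d h := by
    simp [supportedPart]
  have hmR0 : (supportedPart d h : ℝ) ≠ 0 := by exact_mod_cast hm.ne'
  have hdR : (d : ℝ) ≠ 0 := by exact_mod_cast hd0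
  rw [hφ, hmR, ← Finset.mul_prod_erase _ (fun p : ℕ => 1 - (p : ℝ)⁻¹) h2mem,
    ← Finset.mul_prod_erase _ (fun p : ℕ => (p : ℝ) ^ 2 / ((p : ℝ) ^ 2 - 1)) h2mem]
  generalize ∏ p ∈ d.primeFactors.erase 2, (p : ℝ) ^ 2 / ((p : ℝ) ^ 2 - 1) = E
  generalize ∏ p ∈ d.primeFactors.erase 2, (1 - (p : ℝ)⁻¹) = P at hP ⊢
  push_cast
  field_simp
  norm_num
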